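/- arXiv:1904.10871 — 3 statements merged into one kernel-verified Lean document; each statement's English description precedes it below -/
import Mathlib

section
/- Let n, m be positive integers, D ∈ ℝ^{m×n} with rows indexed by a set 𝒟 of size m, S ⊆ 𝒟 with |S| = s < m, N̄_{-S} ⊇ N_{-S} a linear subspace with r̄_S := dim(N̄_{-S}), and Ψ^{-S} = {ψ_j^{-S}}_{j∈𝒟∖S} a dictionary for N̄_{-S}. Let f⁰ ∈ ℝ^n, let ε ∈ ℝ^n have n i.i.d. standard Gaussian N(0,1) coordinates, and Y := f⁰ + ε. Let u > 0, v > 0 and let λ > 0 satisfy λ ≥ max_{j∈𝒟∖S} ‖ψ_j^{-S}‖_n · λ₀(u); set w_j := ‖ψ_j^{-S}‖_n·λ₀(u)/λ for j ∈ 𝒟∖S. Then for every f ∈ ℝ^n and every sign vector q_S ∈ {−1,+1}^s with (q_S)_j = sign((Df)_j) for all j ∈ S with (Df)_j ≠ 0, with probability at least 1 − e^{−u} − e^{−v} (with respect to the law of ε), every minimizer f̂ of g ↦ ‖Y − g‖_n² + 2λ‖Dg‖₁ satisfies ‖f̂ − f⁰‖_n² ≤ ‖f − f⁰‖_n² + 4λ‖(Df)_{-S}‖₁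 + (√(r̄_S/n) + √(2v/n) + λ·Γ(q_S, w_{-S}))². -/
open MeasureTheory ProbabilityTheory Finset

lemma mgf_sq_gaussianReal {t : ℝ} (ht : t < 1 / 2) :
    mgf (fun x : ℝ => x ^ 2) (gaussianReal 0 1) t = (√(1 - 2 * t))⁻¹ := by
  rw [mgf, integral_gaussianReal_eq_integral_smul one_ne_zero]
  have (x : ℝ) : gaussianPDFReal 0 1 x • Real.exp (t * x ^ 2)
      = (√(2 * Real.pi))⁻¹ * Real.exp (-(1 / 2 - t) * x ^ 2) := by
    simp only [gaussianPDFReal, smul_eq_mul, NNReal.coe_one, mul_one, sub_zero]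
    rw [mul_assoc, ← Real.exp_add]
    ring_nf
  simp_rw [this]
  rw [integral_const_mul, integral_gaussian, ← Real.sqrt_inv, ← Real.sqrt_mul (by positivity),
    ← Real.sqrt_inv]
  congr 1
  have := Real.pi_pos
  have : 1 - 2 * t ≠ 0 := by linarith
  have : 1 / 2 - t ≠ 0 := by linarith
  field_simp

lemma integrable_exp_mul_sq_gaussianReal {t : ℝ} (ht : t < 1 / 2) :
    Integrable (fun x : ℝ => Real.exp (t * x ^ 2)) (gaussianReal 0 1) := by
  by_contra h
  have h1 := mgf_sq_gaussianReal ht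
  rw [mgf, integral_undef h] at h1
  have : 0 < √(1 - 2 * t) := Real.sqrt_pos.2 (by linarith)
  have := inv_pos.2 this
  linarith

lemma measure_pi_gaussianReal_sum_sq_le {ι : Type*} [Fintype ι] (s : Finset ι) {v : ℝ}
    (hv : 0 < v) :
    (Measure.pi fun _ : ι => gaussianReal 0 1)
      {x : ι → ℝ | (√(#s : ℝ) + √(2 * v)) ^ 2 < ∑ i ∈ s, x i ^ 2}
        ≤ ENNReal.ofReal (Real.exp (-v)) := by
  set P := Measure.pi fun _ : ι => gaussianReal 0 1 with hP
  rcases s.eq_empty_or_nonempty with rfl | hs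
  · have : {x : ι → ℝ | (√(#(∅ : Finset ι) : ℝ) + √(2 * v)) ^ 2 < ∑ i ∈ (∅ : Finset ι), x i ^ 2}
        = ∅ := by
      ext x
      simp only [Set.mem_ofPred_eq, sum_empty, Set.mem_empty_iff_false, iff_false, not_lt]
      positivity
    rw [this]
    simp
  have hr : (0 : ℝ) < #s := by exact_mod_cast hs.card_pos
  set r : ℝ := (#s : ℝ) with hrdef
  have hR : 0 < √r := Real.sqrt_pos.2 hr
  have hV : 0 < √(2 * v) := Real.sqrt_pos.2 (by linarith)
  have hR2 : √r ^ 2 = r := Real.sq_sqrt hr.le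
  have hV2 : √(2 * v) ^ 2 = 2 * v := Real.sq_sqrt (by linarith)
  set R := √r
  set V := √(2 * v)
  have hc : 0 < R + V := by positivity
  set t : ℝ := (1 - (R / (R + V)) ^ 2) / 2 with ht
  have hq0 : 0 < R / (R + V) := by positivity
  have hq1 : R / (R + V) ≤ 1 := (div_le_one hc).2 (by linarith)
  have ht0 : 0 ≤ t := by
    have : (R / (R + V)) ^ 2 ≤ 1 := pow_le_one₀ hq0.le hq1
    rw [ht]; linarith
  have ht1 : t < 1 / 2 := by
    have : 0 < (R / (R + V)) ^ 2 := by positivity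
    rw [ht]; linarith
  have hind : iIndepFun (fun (i : ι) (x : ι → ℝ) => x i ^ 2) P :=
    iIndepFun_pi (X := fun _ x => x ^ 2) (fun i => by fun_prop)
  have hmeas : ∀ i : ι, Measurable (fun x : ι → ℝ => x i ^ 2) := fun i => by fun_prop
  have hmp (i : ι) : MeasurePreserving (Function.eval i) P (gaussianReal 0 1) :=
    measurePreserving_eval (fun _ : ι => gaussianReal 0 1) i
  have hint := hind.integrable_exp_mul_sum (t := t) hmeas (s := s) (fun i _ =>
    (hmp i).integrable_comp_of_integrable (integrable_exp_mul_sq_gaussianReal ht1))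
  have hmgf (i : ι) : mgf (fun x : ι → ℝ => x i ^ 2) P t = 1 + V / R := by
    have h1 : mgf (fun x : ι → ℝ => x i ^ 2) P t
        = mgf (fun x : ℝ => x ^ 2) (gaussianReal 0 1) t := by
      rw [← (hmp i).map_eq, mgf_map (hmp i).aemeasurable (by fun_prop)]
      rfl
    rw [h1, mgf_sq_gaussianReal ht1, ht, show 1 - 2 * ((1 - (R / (R + V)) ^ 2) / 2)
      = (R / (R + V)) ^ 2 by ring, Real.sqrt_sq hq0.le]
    field_simp
  have key := measure_ge_le_exp_mul_mgf ((R + V) ^ 2) ht0 hint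
  rw [hind.mgf_sum hmeas] at key
  simp only [hmgf, prod_const] at key
  have hbound : Real.exp (-t * (R + V) ^ 2) * (1 + V / R) ^ #s ≤ Real.exp (-v) := by
    have h1 : (1 + V / R) ^ #s ≤ Real.exp (R * V) := by
      calc (1 + V / R) ^ #s ≤ Real.exp (V / R) ^ #s := by
            gcongr
            linarith [Real.add_one_le_exp (V / R)]
        _ = Real.exp (R * V) := by
            rw [← Real.exp_nat_mul, ← hrdef, ← hR2]
            congr 1
            field_simp
    calc _ ≤ Real.exp (-t * (R + V) ^ 2) * Real.exp (R * V) := by gcongr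
      _ = Real.exp (-v) := by
        rw [← Real.exp_add, ht]
        congr 1
        have : (R / (R + V)) ^ 2 * (R + V) ^ 2 = R ^ 2 := by field_simp
        linear_combination this / 2 - hV2 / 2
  refine (measure_mono (fun x hx => ?_)).trans
    ((ENNReal.le_ofReal_iff_toReal_le (measure_ne_top _ _) (Real.exp_pos _).le).2
      (key.trans hbound))
  simp only [Set.mem_ofPred_eq, Finset.sum_apply] at hx ⊢
  exact hx.le

lemma measure_stdGaussian_exists_lt_inner_le {E : Type*} [NormedAddCommGroup E]
    [InnerProductSpace ℝ E] [FiniteDimensional ℝ E] [MeasurableSpace E] [BorelSpace E]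
    (K : Submodule ℝ E) {v : ℝ} (hv : 0 < v) :
    stdGaussian E
      {y : E | ∃ g ∈ K, (√(Module.finrank ℝ K : ℝ) + √(2 * v)) * ‖g‖ < inner ℝ y g}
        ≤ ENNReal.ofReal (Real.exp (-v)) := by
  let b := ((stdOrthonormalBasis ℝ K).prod (stdOrthonormalBasis ℝ Kᗮ)).map
    K.orthogonalDecomposition.symm
  have hb (j) : b (Sum.inr j) ∈ Kᗮ := by simp [b]
  let s : Finset (Fin (Module.finrank ℝ K) ⊕ Fin (Module.finrank ℝ Kᗮ)) := univ.map .inl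
  have hs : #s = Module.finrank ℝ K := by simp [s]
  let c := √(Module.finrank ℝ K : ℝ) + √(2 * v)
  have hc : 0 ≤ c := by positivity
  have hsub : {y : E | ∃ g ∈ K, c * ‖g‖ < inner ℝ y g}
      ⊆ {y : E | c ^ 2 < ∑ i ∈ s, inner ℝ y (b i) ^ 2} := by
    rintro y ⟨g, hg, hlt⟩
    rw [Set.mem_ofPred_eq]
    by_contra! hle
    have h1 : inner ℝ y g = ∑ i ∈ s, inner ℝ y (b i) * inner ℝ (b i) g := by
      rw [← b.sum_inner_mul_inner y g, Fintype.sum_sum_type, sum_map]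
      simp [Submodule.inner_left_of_mem_orthogonal hg (hb _)]
    have h2 : ∑ i ∈ s, inner ℝ (b i) g ^ 2 ≤ ‖g‖ ^ 2 := by
      rw [← b.sum_sq_inner_right g]
      exact sum_le_sum_of_subset_of_nonneg (f := fun i => inner ℝ (b i) g ^ 2) (subset_univ s)
        fun i _ _ => sq_nonneg _
    have h3 := sum_mul_sq_le_sq_mul_sq s (fun i => inner ℝ y (b i)) (fun i => inner ℝ (b i) g)
    rw [← h1] at h3
    have h4 : inner ℝ y g ^ 2 ≤ (c * ‖g‖) ^ 2 := by
      rw [mul_pow]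
      exact h3.trans (mul_le_mul hle h2 (sum_nonneg fun i _ => sq_nonneg _) (sq_nonneg c))
    exact absurd (abs_le_of_sq_le_sq' h4 (by positivity)).2 (not_le.2 hlt)
  refine (measure_mono hsub).trans ?_
  rw [stdGaussian_eq_map_pi_orthonormalBasis b, Measure.map_apply (by fun_prop)
    (measurableSet_lt (by fun_prop) (by fun_prop))]
  have h := measure_pi_gaussianReal_sum_sq_le s hv
  rw [hs] at h
  refine le_of_eq_of_le (congrArg _ ?_) h
  ext x
  have hx (i) : inner ℝ (∑ k, x k • b k) (b i) = x i := by
    simp [-Fintype.sum_sum_type, sum_inner, inner_smul_left, b.inner_eq_ite]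
  simp only [Set.mem_preimage, Set.mem_ofPred_eq, hx, c]

lemma hasSubgaussianMGF_gaussianReal_const_mul (c : ℝ) :
    HasSubgaussianMGF (fun x : ℝ => c * x) (‖c‖₊ ^ 2) (gaussianReal 0 1) where
  integrable_exp_mul t := by
    simpa [mul_assoc] using integrable_exp_mul_gaussianReal (μ := 0) (v := 1) (t * c)
  mgf_le t := by
    rw [mgf_gaussianReal (gaussianReal_map_const_mul c)]
    simp [sq_abs]

lemma measure_pi_gaussianReal_lt_sum_le {ι : Type*} [Fintype ι] (p : ι → ℝ) {a : ℝ}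
    (ha : 0 ≤ a) :
    (Measure.pi fun _ : ι => gaussianReal 0 1)
      {x : ι → ℝ | a * √(∑ i, p i ^ 2) < ∑ i, x i * p i}
        ≤ ENNReal.ofReal (Real.exp (-a ^ 2 / 2)) := by
  rcases (sum_nonneg fun i _ => sq_nonneg (p i) : 0 ≤ ∑ i, p i ^ 2).eq_or_lt with h0 | hpos
  · have hp (i : ι) : p i = 0 := by
      have := (sum_eq_zero_iff_of_nonneg fun i _ => sq_nonneg (p i)).1 h0.symm i (mem_univ i)
      simpa using this
    simp [hp]
  have hsub (i : ι) : HasSubgaussianMGF (fun x : ι → ℝ => p i * x i) (‖p i‖₊ ^ 2)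
      (Measure.pi fun _ : ι => gaussianReal 0 1) := by
    have h := hasSubgaussianMGF_gaussianReal_const_mul (p i)
    rw [← (measurePreserving_eval (fun _ : ι => gaussianReal 0 1) i).map_eq] at h
    exact h.of_map (measurable_pi_apply i).aemeasurable
  have hind : iIndepFun (fun (i : ι) (x : ι → ℝ) => p i * x i)
      (Measure.pi fun _ : ι => gaussianReal 0 1) :=
    iIndepFun_pi (X := fun i x => p i * x) (fun i => by fun_prop)
  have key := HasSubgaussianMGF.measure_sum_ge_le_of_iIndepFun hind (s := univ)
    (fun i _ => hsub i) (ε := a * √(∑ i, p i ^ 2)) (by positivity)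
  refine (measure_mono (fun x hx => ?_)).trans
    ((ENNReal.le_ofReal_iff_toReal_le (measure_ne_top _ _) (Real.exp_pos _).le).2
      (key.trans_eq ?_))
  · simp only [Set.mem_ofPred_eq] at hx ⊢
    simp_rw [mul_comm (p _)]
    exact hx.le
  · congr 1
    rw [mul_pow, Real.sq_sqrt hpos.le]
    push_cast
    simp only [Real.norm_eq_abs, sq_abs]
    field_simp

lemma measure_pi_gaussianReal_lt_abs_sum_le {ι : Type*} [Fintype ι] (p : ι → ℝ) {a : ℝ}
    (ha : 0 ≤ a) :
    (Measure.pi fun _ : ι => gaussianReal 0 1)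
      {x : ι → ℝ | a * √(∑ i, p i ^ 2) < |∑ i, x i * p i|}
        ≤ ENNReal.ofReal (2 * Real.exp (-a ^ 2 / 2)) := by
  have hsub : {x : ι → ℝ | a * √(∑ i, p i ^ 2) < |∑ i, x i * p i|}
      ⊆ {x | a * √(∑ i, p i ^ 2) < ∑ i, x i * p i}
        ∪ {x | a * √(∑ i, (-p) i ^ 2) < ∑ i, x i * (-p) i} := by
    intro x hx
    rcases lt_abs.1 (Set.mem_ofPred_eq ▸ hx) with h | h
    · exact Or.inl h
    · right; simpa using h
  refine (measure_mono hsub).trans ((measure_union_le _ _).trans ?_)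
  rw [two_mul, ENNReal.ofReal_add (Real.exp_pos _).le (Real.exp_pos _).le]
  exact add_le_add (measure_pi_gaussianReal_lt_sum_le p ha)
    (measure_pi_gaussianReal_lt_sum_le (-p) ha)

lemma measure_pi_gaussianReal_exists_lt_sum_le {n : ℕ} (K : Submodule ℝ (Fin n → ℝ)) {v : ℝ}
    (hv : 0 < v) :
    (Measure.pi fun _ : Fin n => gaussianReal 0 1)
      {x : Fin n → ℝ | ∃ g ∈ K,
        (√(Module.finrank ℝ K : ℝ) + √(2 * v)) * √(∑ i, g i ^ 2) < ∑ i, x i * g i}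
        ≤ ENNReal.ofReal (Real.exp (-v)) := by
  let e := (WithLp.linearEquiv 2 ℝ (Fin n → ℝ)).symm
  have h := measure_stdGaussian_exists_lt_inner_le
    (K.map (e : (Fin n → ℝ) →ₗ[ℝ] EuclideanSpace ℝ (Fin n))) hv
  rw [LinearEquiv.finrank_map_eq, ← map_pi_eq_stdGaussian] at h
  refine (measure_mono fun x hx => ?_).trans ((Measure.le_map_apply (by fun_prop) _).trans h)
  obtain ⟨g, hg, hlt⟩ := hx
  refine ⟨e g, Submodule.mem_map_of_mem hg, ?_⟩
  rw [EuclideanSpace.norm_eq, PiLp.inner_apply]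
  simpa [e, mul_comm] using hlt

section Deterministic

variable {n m : ℕ}

lemma penalized_basic_inequality (D : Matrix (Fin m) (Fin n) ℝ) {lam : ℝ} (hlam : 0 < lam)
    (f0 ε f fhat : Fin n → ℝ)
    (hmin : ∀ g : Fin n → ℝ,
      (∑ i, (f0 i + ε i - fhat i) ^ 2) / n + 2 * lam * ∑ j, |D.mulVec fhat j| ≤
        (∑ i, (f0 i + ε i - g i) ^ 2) / n + 2 * lam * ∑ j, |D.mulVec g j|) :
    (∑ i, (fhat i - f0 i) ^ 2) / n + (∑ i, (fhat i - f i) ^ 2) / n ≤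
      (∑ i, (f i - f0 i) ^ 2) / n + 2 * ((∑ i, ε i * (fhat i - f i)) / n)
        + 2 * lam * (∑ j, |D.mulVec f j| - ∑ j, |D.mulVec fhat j|) := by
  set X : ℝ := 2 * ((∑ i, (f0 i + ε i - fhat i) * (fhat i - f i)) / n)
    + 2 * lam * (∑ j, |D.mulVec f j| - ∑ j, |D.mulVec fhat j|) with hX
  set H : ℝ := (∑ i, (fhat i - f i) ^ 2) / n with hH
  have hH0 : 0 ≤ H := by positivity
  have hstep (t : ℝ) (ht0 : 0 < t) (ht1 : t ≤ 1) : 0 ≤ X + t * H := by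
    have h := hmin (fhat + t • (f - fhat))
    have h1 : ∑ i, (f0 i + ε i - (fhat + t • (f - fhat)) i) ^ 2
        = ∑ i, (f0 i + ε i - fhat i) ^ 2
          + 2 * t * ∑ i, (f0 i + ε i - fhat i) * (fhat i - f i)
          + t ^ 2 * ∑ i, (fhat i - f i) ^ 2 := by
      rw [mul_sum, mul_sum, ← sum_add_distrib, ← sum_add_distrib]
      refine sum_congr rfl fun i _ => ?_
      simp only [Pi.add_apply, Pi.smul_apply, Pi.sub_apply, smul_eq_mul]
      ring
    have h2 : ∑ j, |D.mulVec (fhat + t • (f - fhat)) j|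
        ≤ (1 - t) * ∑ j, |D.mulVec fhat j| + t * ∑ j, |D.mulVec f j| := by
      rw [mul_sum, mul_sum, ← sum_add_distrib]
      refine sum_le_sum fun j _ => ?_
      rw [Matrix.mulVec_add, Matrix.mulVec_smul, Matrix.mulVec_sub]
      simp only [Pi.add_apply, Pi.smul_apply, Pi.sub_apply, smul_eq_mul]
      calc _ = |(1 - t) * D.mulVec fhat j + t * D.mulVec f j| := by ring_nf
        _ ≤ |(1 - t) * D.mulVec fhat j| + |t * D.mulVec f j| := abs_add_le _ _
        _ = _ := by rw [abs_mul, abs_mul, abs_of_pos ht0, abs_of_nonneg (sub_nonneg.2 ht1)]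
    have h3 := mul_le_mul_of_nonneg_left h2 (by positivity : 0 ≤ 2 * lam)
    rw [h1, add_div, add_div] at h
    have h4 : 0 ≤ t * (X + t * H) := by
      rw [hX, hH]
      linear_combination h + h3
    exact nonneg_of_mul_nonneg_right h4 ht0
  have hX0 : 0 ≤ X := by
    by_contra! hneg
    have hd : 0 < 2 * (H - X) := by linarith
    have h := hstep (-X / (2 * (H - X))) (div_pos (by linarith) hd)
      ((div_le_one hd).2 (by linarith))
    have h' : -X / (2 * (H - X)) * H ≤ -X / 2 := by
      rw [div_mul_eq_mul_div, div_le_div_iff₀ hd two_pos]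
      nlinarith
    linarith
  have hid : ∑ i, (fhat i - f0 i) ^ 2 + ∑ i, (fhat i - f i) ^ 2
      = ∑ i, (f i - f0 i) ^ 2 + 2 * ∑ i, ε i * (fhat i - f i)
        - 2 * ∑ i, (f0 i + ε i - fhat i) * (fhat i - f i) := by
    simp only [mul_sum, ← sum_add_distrib, ← sum_sub_distrib]
    exact sum_congr rfl fun i _ => by ring
  have hid' := congrArg (· / (n : ℝ)) hid
  simp only [add_div, sub_div] at hid'
  rw [hX] at hX0
  linear_combination hX0 + hid'

lemma sum_abs_sub_sum_abs_le {ι : Type*} [Fintype ι] [DecidableEq ι] (S : Finset ι)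
    (a b q : ι → ℝ) (hq1 : ∀ j ∈ S, q j = 1 ∨ q j = -1)
    (hq2 : ∀ j ∈ S, a j ≠ 0 → q j = Real.sign (a j)) :
    ∑ j, |a j| - ∑ j, |b j| ≤
      2 * ∑ j ∈ Sᶜ, |a j| - ∑ j ∈ S, q j * (b j - a j) - ∑ j ∈ Sᶜ, |b j - a j| := by
  rw [← sum_add_sum_compl S (fun j => |a j|), ← sum_add_sum_compl S (fun j => |b j|)]
  have h1 : ∑ j ∈ S, |a j| - ∑ j ∈ S, |b j| ≤ - ∑ j ∈ S, q j * (b j - a j) := by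
    rw [← sum_sub_distrib, ← sum_neg_distrib]
    refine sum_le_sum fun j hj => ?_
    have ha : q j * a j = |a j| := by
      rcases eq_or_ne (a j) 0 with h0 | h0
      · simp [h0]
      · rw [hq2 j hj h0]
        rcases h0.lt_or_gt with h | h
        · rw [Real.sign_of_neg h, abs_of_neg h]; ring
        · rw [Real.sign_of_pos h, abs_of_pos h]; ring
    have hb : q j * b j ≤ |b j| := by
      rcases hq1 j hj with h | h <;> rw [h]
      · simpa using le_abs_self (b j)
      · simpa using neg_le_abs (b j)
    linarith
  have h2 : ∑ j ∈ Sᶜ, |a j| - ∑ j ∈ Sᶜ, |b j|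
      ≤ 2 * ∑ j ∈ Sᶜ, |a j| - ∑ j ∈ Sᶜ, |b j - a j| := by
    rw [← sum_sub_distrib, mul_sum, ← sum_sub_distrib]
    refine sum_le_sum fun j _ => ?_
    linarith [abs_sub (b j) (a j)]
  linarith

lemma bddAbove_noisy_effective_sparsity (hn : 0 < n) (D : Matrix (Fin m) (Fin n) ℝ)
    (S : Finset (Fin m)) (q w : Fin m → ℝ) (hw : ∀ j, j ∉ S → w j ≤ 1) :
    BddAbove {x : ℝ | ∃ g : Fin n → ℝ, (∑ i, g i ^ 2) / n = 1 ∧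
      x = (∑ j ∈ S, q j * D.mulVec g j) - ∑ j ∈ Sᶜ, (1 - w j) * |D.mulVec g j|} := by
  have hn' : (0 : ℝ) < n := by exact_mod_cast hn
  refine ⟨∑ j ∈ S, |q j| * ∑ i, |D j i| * √n, ?_⟩
  rintro x ⟨g, hg, rfl⟩
  have hg' : ∑ i, g i ^ 2 = n := by
    rw [div_eq_one_iff_eq hn'.ne'] at hg
    exact hg
  have hgi (i : Fin n) : |g i| ≤ √n := by
    refine Real.abs_le_sqrt ?_
    rw [← hg']
    exact single_le_sum (f := fun i => g i ^ 2) (fun i _ => sq_nonneg _) (mem_univ i)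
  have h1 : 0 ≤ ∑ j ∈ Sᶜ, (1 - w j) * |D.mulVec g j| :=
    sum_nonneg fun j hj => mul_nonneg (sub_nonneg.2 (hw j (mem_compl.1 hj))) (abs_nonneg _)
  have h2 : ∑ j ∈ S, q j * D.mulVec g j ≤ ∑ j ∈ S, |q j| * ∑ i, |D j i| * √n := by
    refine sum_le_sum fun j _ => (le_abs_self _).trans ?_
    rw [abs_mul]
    refine mul_le_mul_of_nonneg_left ?_ (abs_nonneg _)
    change |∑ i, D j i * g i| ≤ _
    refine (abs_sum_le_sum_abs _ _).trans (sum_le_sum fun i _ => ?_)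
    rw [abs_mul]
    exact mul_le_mul_of_nonneg_left (hgi i) (abs_nonneg _)
  linarith

lemma le_noisy_effective_sparsity_mul (hn : 0 < n) (D : Matrix (Fin m) (Fin n) ℝ)
    (S : Finset (Fin m)) (q w : Fin m → ℝ) (hw : ∀ j, j ∉ S → w j ≤ 1) (g : Fin n → ℝ) :
    (∑ j ∈ S, q j * D.mulVec g j) - ∑ j ∈ Sᶜ, (1 - w j) * |D.mulVec g j| ≤
      sSup {x : ℝ | ∃ g : Fin n → ℝ, (∑ i, g i ^ 2) / n = 1 ∧
        x = (∑ j ∈ S, q j * D.mulVec g j) - ∑ j ∈ Sᶜ, (1 - w j) * |D.mulVec g j|}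
        * √((∑ i, g i ^ 2) / n) := by
  have hn' : (0 : ℝ) < n := by exact_mod_cast hn
  rcases (sum_nonneg fun i _ => sq_nonneg (g i) : 0 ≤ ∑ i, g i ^ 2).eq_or_lt with h0 | hpos
  · have hg : g = 0 := by
      ext i
      have := (sum_eq_zero_iff_of_nonneg fun i _ => sq_nonneg (g i)).1 h0.symm i (mem_univ i)
      simpa using this
    simp [hg]
  set a := √((∑ i, g i ^ 2) / n) with ha
  have hapos : 0 < a := Real.sqrt_pos.2 (by positivity)
  have ha2 : a ^ 2 = (∑ i, g i ^ 2) / n := Real.sq_sqrt (by positivity)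
  rw [← div_le_iff₀ hapos]
  refine le_csSup (bddAbove_noisy_effective_sparsity hn D S q w hw) ⟨a⁻¹ • g, ?_, ?_⟩
  · simp only [Pi.smul_apply, smul_eq_mul, mul_pow]
    rw [← mul_sum, mul_div_assoc, ← ha2]
    field_simp
  · rw [Matrix.mulVec_smul]
    simp only [Pi.smul_apply, smul_eq_mul, abs_mul, abs_of_pos (inv_pos.2 hapos)]
    rw [div_eq_inv_mul, mul_sub, mul_sum, mul_sum]
    congr 1 <;> exact sum_congr rfl fun j _ => by ring

lemma noise_inner_le (hn : 0 < n) (D : Matrix (Fin m) (Fin n) ℝ) (S : Finset (Fin m))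
    (Nbar : Submodule ℝ (Fin n → ℝ)) (ψ : Fin m → (Fin n → ℝ))
    (hdict : ∀ f : Fin n → ℝ,
      f - (∑ j ∈ Sᶜ, D.mulVec f j • ψ j) ∈ Nbar ∧
      ∀ g ∈ Nbar, (∑ i, (∑ j ∈ Sᶜ, D.mulVec f j • ψ j) i * g i) = 0)
    {C : ℝ} (hC : 0 ≤ C) (κ : Fin m → ℝ) (ε : Fin n → ℝ)
    (hN : ∀ g ∈ Nbar, ∑ i, ε i * g i ≤ C * √(∑ i, g i ^ 2))
    (hψ : ∀ j, j ∉ S → |∑ i, ε i * ψ j i| / n ≤ κ j) (h : Fin n → ℝ) :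
    (∑ i, ε i * h i) / n ≤
      C / √n * √((∑ i, h i ^ 2) / n) + ∑ j ∈ Sᶜ, κ j * |D.mulVec h j| := by
  have hn' : (0 : ℝ) < n := by exact_mod_cast hn
  obtain ⟨hp, horth⟩ := hdict h
  set r : Fin n → ℝ := ∑ j ∈ Sᶜ, D.mulVec h j • ψ j with hr
  have hpyth : ∑ i, (h - r) i ^ 2 ≤ ∑ i, h i ^ 2 := by
    have h1 : ∑ i, h i ^ 2 = ∑ i, (h - r) i ^ 2 + 2 * ∑ i, r i * (h - r) i + ∑ i, r i ^ 2 := by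
      rw [mul_sum, ← sum_add_distrib, ← sum_add_distrib]
      refine sum_congr rfl fun i _ => ?_
      simp only [Pi.sub_apply]
      ring
    rw [h1, horth _ hp]
    have : 0 ≤ ∑ i, r i ^ 2 := sum_nonneg fun i _ => sq_nonneg _
    linarith
  have hsplit : ∑ i, ε i * h i = ∑ i, ε i * (h - r) i + ∑ i, ε i * r i := by
    rw [← sum_add_distrib]
    exact sum_congr rfl fun i _ => by simp only [Pi.sub_apply]; ring
  have h1 : (∑ i, ε i * (h - r) i) / n ≤ C / √n * √((∑ i, h i ^ 2) / n) := by
    have : C / √n * √((∑ i, h i ^ 2) / n) = C * √(∑ i, h i ^ 2) / n := by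
      rw [Real.sqrt_div' _ hn'.le, div_mul_div_comm, Real.mul_self_sqrt hn'.le]
    rw [this]
    gcongr
    exact (hN _ hp).trans (by gcongr)
  have h2 : (∑ i, ε i * r i) / n ≤ ∑ j ∈ Sᶜ, κ j * |D.mulVec h j| := by
    have : (∑ i, ε i * r i) / n = ∑ j ∈ Sᶜ, D.mulVec h j * ((∑ i, ε i * ψ j i) / n) := by
      simp only [hr, Finset.sum_apply, Pi.smul_apply, smul_eq_mul, mul_sum, sum_div]
      rw [sum_comm]
      exact sum_congr rfl fun j _ => sum_congr rfl fun i _ => by ring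
    rw [this]
    refine sum_le_sum fun j hj => (le_abs_self _).trans ?_
    rw [abs_mul, mul_comm, abs_div, abs_of_pos hn']
    exact mul_le_mul_of_nonneg_right (hψ j (mem_compl.1 hj)) (abs_nonneg _)
  rw [hsplit, add_div]
  exact add_le_add h1 h2

lemma adaptive_bound_of_noise_bounds (hn : 0 < n) (D : Matrix (Fin m) (Fin n) ℝ)
    (S : Finset (Fin m)) (Nbar : Submodule ℝ (Fin n → ℝ)) (ψ : Fin m → (Fin n → ℝ))
    (hdict : ∀ f : Fin n → ℝ,
      f - (∑ j ∈ Sᶜ, D.mulVec f j • ψ j) ∈ Nbar ∧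
      ∀ g ∈ Nbar, (∑ i, (∑ j ∈ Sᶜ, D.mulVec f j • ψ j) i * g i) = 0)
    {lam : ℝ} (hlam : 0 < lam) (w q : Fin m → ℝ) (hw : ∀ j, j ∉ S → w j ≤ 1)
    {C : ℝ} (hC : 0 ≤ C) (f0 ε f fhat : Fin n → ℝ)
    (hq1 : ∀ j ∈ S, q j = 1 ∨ q j = -1)
    (hq2 : ∀ j ∈ S, D.mulVec f j ≠ 0 → q j = Real.sign (D.mulVec f j))
    (hN : ∀ g ∈ Nbar, ∑ i, ε i * g i ≤ C * √(∑ i, g i ^ 2))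
    (hψ : ∀ j, j ∉ S → |∑ i, ε i * ψ j i| / n ≤ lam * w j)
    (hmin : ∀ g : Fin n → ℝ,
      (∑ i, (f0 i + ε i - fhat i) ^ 2) / n + 2 * lam * ∑ j, |D.mulVec fhat j| ≤
        (∑ i, (f0 i + ε i - g i) ^ 2) / n + 2 * lam * ∑ j, |D.mulVec g j|) :
    (∑ i, (fhat i - f0 i) ^ 2) / n ≤
      (∑ i, (f i - f0 i) ^ 2) / n + 4 * lam * ∑ j ∈ Sᶜ, |D.mulVec f j|
        + (C / √n + lam * sSup {x : ℝ | ∃ g : Fin n → ℝ, (∑ i, g i ^ 2) / n = 1 ∧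
            x = (∑ j ∈ S, q j * D.mulVec g j)
              - ∑ j ∈ Sᶜ, (1 - w j) * |D.mulVec g j|}) ^ 2 := by
  have hbasic := penalized_basic_inequality D hlam f0 ε f fhat hmin
  have hpen := sum_abs_sub_sum_abs_le S (D.mulVec f) (D.mulVec fhat) q hq1 hq2
  have hnoise := noise_inner_le hn D S Nbar ψ hdict hC (fun j => lam * w j) ε hN hψ (fhat - f)
  have hsp := le_noisy_effective_sparsity_mul hn D S q w hw (f - fhat)
  set Γ := sSup {x : ℝ | ∃ g : Fin n → ℝ, (∑ i, g i ^ 2) / n = 1 ∧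
    x = (∑ j ∈ S, q j * D.mulVec g j) - ∑ j ∈ Sᶜ, (1 - w j) * |D.mulVec g j|}
  simp only [Matrix.mulVec_sub, Pi.sub_apply] at hnoise hsp
  have e1 : ∑ i, (f i - fhat i) ^ 2 = ∑ i, (fhat i - f i) ^ 2 :=
    sum_congr rfl fun i _ => by ring
  have e2 : ∑ j ∈ S, q j * (D.mulVec f j - D.mulVec fhat j)
      = - ∑ j ∈ S, q j * (D.mulVec fhat j - D.mulVec f j) := by
    rw [← sum_neg_distrib]
    exact sum_congr rfl fun i _ => by ring
  have e3 : ∑ j ∈ Sᶜ, (1 - w j) * |D.mulVec f j - D.mulVec fhat j|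
      = ∑ j ∈ Sᶜ, |D.mulVec fhat j - D.mulVec f j|
        - ∑ j ∈ Sᶜ, w j * |D.mulVec fhat j - D.mulVec f j| := by
    rw [← sum_sub_distrib]
    exact sum_congr rfl fun i _ => by rw [abs_sub_comm]; ring
  have e4 : ∑ j ∈ Sᶜ, lam * w j * |D.mulVec fhat j - D.mulVec f j|
      = lam * ∑ j ∈ Sᶜ, w j * |D.mulVec fhat j - D.mulVec f j| := by
    rw [mul_sum]
    exact sum_congr rfl fun i _ => by ring
  rw [e1, e2, e3] at hsp
  rw [e4] at hnoise
  set H := (∑ i, (fhat i - f i) ^ 2) / (n : ℝ)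
  have hH : √H ^ 2 = H := Real.sq_sqrt (by positivity)
  have hpen' := mul_le_mul_of_nonneg_left hpen hlam.le
  have hsp' := mul_le_mul_of_nonneg_left hsp hlam.le
  have hsq := sq_nonneg (√H - (C / √n + lam * Γ))
  linear_combination hbasic + 2 * hpen' + 2 * hnoise + 2 * hsp' + hsq + hH

end Deterministic

/-- adaptive bound of Theorem 2.2: with probability at least
`1 - e^{-u} - e^{-v}`, every minimizer `f̂` of `g ↦ ‖Y - g‖ₙ² + 2λ‖Dg‖₁` satisfies
`‖f̂ - f⁰‖ₙ² ≤ ‖f - f⁰‖ₙ² + 4λ‖(Df)_{-S}‖₁ + (√(r̄_S/n) + √(2v/n) + λΓ(q_S, w_{-S}))²`. -/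
theorem stmt_1
    (n m : ℕ) (hn : 0 < n) (hm : 0 < m)
    (D : Matrix (Fin m) (Fin n) ℝ)
    (S : Finset (Fin m)) (hs : S.card < m)
    -- `Nbar` is a linear subspace containing `N_{-S} = {f : (Df)_j = 0 ∀ j ∉ S}`
    (Nbar : Submodule ℝ (Fin n → ℝ))
    (hsub : ∀ f : Fin n → ℝ, (∀ j, j ∉ S → D.mulVec f j = 0) → f ∈ Nbar)
    -- `ψ` is a dictionary for `Nbar`: for every `f`, the orthogonal projection of `f`
    -- onto the orthogonal complement of `Nbar` is `∑_{j ∉ S} (Df)_j • ψ_j`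
    (ψ : Fin m → (Fin n → ℝ))
    (hdict : ∀ f : Fin n → ℝ,
      f - (∑ j ∈ Sᶜ, D.mulVec f j • ψ j) ∈ Nbar ∧
      ∀ g ∈ Nbar, (∑ i, (∑ j ∈ Sᶜ, D.mulVec f j • ψ j) i * g i) = 0)
    (f0 : Fin n → ℝ)
    (u v lam : ℝ) (hu : 0 < u) (hv : 0 < v) (hlam : 0 < lam)
    -- `λ₀(u) = √((2 log(2(m-s)) + 2u)/n)`
    (lam0 : ℝ)
    (hlam0 : lam0 = Real.sqrt ((2 * Real.log (2 * ((m : ℝ) - S.card)) + 2 * u) / n))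
    -- `λ ≥ max_{j ∉ S} ‖ψⱼ‖ₙ λ₀(u)`
    (hlam2 : ∀ j, j ∉ S → Real.sqrt ((∑ i, ψ j i ^ 2) / n) * lam0 ≤ lam)
    -- the weights `w_j = ‖ψⱼ‖ₙ λ₀(u)/λ` for `j ∉ S`
    (w : Fin m → ℝ)
    (hw : ∀ j, j ∉ S → w j = Real.sqrt ((∑ i, ψ j i ^ 2) / n) * lam0 / lam)
    (f : Fin n → ℝ)
    -- the sign vector `q_S ∈ {-1,+1}^s` with `q_j = sign((Df)_j)` whenever `(Df)_j ≠ 0`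
    (q : Fin m → ℝ)
    (hq1 : ∀ j ∈ S, q j = 1 ∨ q j = -1)
    (hq2 : ∀ j ∈ S, D.mulVec f j ≠ 0 → q j = Real.sign (D.mulVec f j))
    -- the noisy effective sparsity `Γ(q_S, w_{-S})`
    (Γ : ℝ)
    (hΓ : Γ = sSup {x : ℝ | ∃ g : Fin n → ℝ, (∑ i, g i ^ 2) / n = 1 ∧
      x = (∑ j ∈ S, q j * D.mulVec g j) - ∑ j ∈ Sᶜ, (1 - w j) * |D.mulVec g j|}) :
    ENNReal.ofReal (1 - Real.exp (-u) - Real.exp (-v)) ≤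
      (Measure.pi fun _ : Fin n => gaussianReal 0 1)
        {ε : Fin n → ℝ |
          ∀ fhat : Fin n → ℝ,
            (∀ g : Fin n → ℝ,
              (∑ i, (f0 i + ε i - fhat i) ^ 2) / n
                  + 2 * lam * ∑ j, |D.mulVec fhat j| ≤
                (∑ i, (f0 i + ε i - g i) ^ 2) / n
                  + 2 * lam * ∑ j, |D.mulVec g j|) →
            (∑ i, (fhat i - f0 i) ^ 2) / n ≤
              (∑ i, (f i - f0 i) ^ 2) / n
                + 4 * lam * ∑ j ∈ Sᶜ, |D.mulVec f j|
                + (Real.sqrt ((Module.finrank ℝ Nbar : ℝ) / n)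
                    + Real.sqrt (2 * v / n) + lam * Γ) ^ 2} := by
  have hn' : (0 : ℝ) < n := by exact_mod_cast hn
  set P := Measure.pi fun _ : Fin n => gaussianReal 0 1 with hP
  have hms : (1 : ℝ) ≤ (m : ℝ) - #S := by
    have : (#S : ℝ) + 1 ≤ m := by exact_mod_cast hs
    linarith
  have hcard : (#Sᶜ : ℝ) = (m : ℝ) - #S := by
    rw [card_compl, Fintype.card_fin, Nat.cast_sub hs.le]
  set L : ℝ := 2 * Real.log (2 * ((m : ℝ) - #S)) + 2 * u with hL
  have hL0 : 0 ≤ L := by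
    have := Real.log_nonneg (by linarith : 1 ≤ 2 * ((m : ℝ) - #S))
    positivity
  set C := √(Module.finrank ℝ Nbar : ℝ) + √(2 * v) with hC
  have hC0 : 0 ≤ C := by positivity
  let A : Set (Fin n → ℝ) := {ε | ∃ g ∈ Nbar, C * √(∑ i, g i ^ 2) < ∑ i, ε i * g i}
  let B (j : Fin m) : Set (Fin n → ℝ) := {ε | √L * √(∑ i, ψ j i ^ 2) < |∑ i, ε i * ψ j i|}
  have hA : P A ≤ ENNReal.ofReal (Real.exp (-v)) :=
    measure_pi_gaussianReal_exists_lt_sum_le Nbar hv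
  have hB : P (⋃ j ∈ Sᶜ, B j) ≤ ENNReal.ofReal (Real.exp (-u)) := by
    refine (measure_biUnion_finset_le _ _).trans ((sum_le_sum fun j _ =>
      measure_pi_gaussianReal_lt_abs_sum_le (ψ j) (Real.sqrt_nonneg L)).trans_eq ?_)
    rw [sum_const, ← ENNReal.ofReal_nsmul, nsmul_eq_mul, hcard, Real.sq_sqrt hL0]
    congr 1
    rw [show -L / 2 = -u - Real.log (2 * ((m : ℝ) - #S)) by rw [hL]; ring, Real.exp_sub,
      Real.exp_log (by linarith)]
    field_simp
  set G : Set (Fin n → ℝ) := {ε : Fin n → ℝ | ∀ fhat : Fin n → ℝ, _ → _}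
  have hsubset : Set.univ ⊆ G ∪ (A ∪ ⋃ j ∈ Sᶜ, B j) := by
    intro ε _
    by_cases hbad : ε ∈ A ∪ ⋃ j ∈ Sᶜ, B j
    · exact Or.inr hbad
    left
    simp only [Set.mem_union, Set.mem_iUnion, not_or, not_exists] at hbad
    obtain ⟨hεA, hεB⟩ := hbad
    intro fhat hmin
    have hw1 : ∀ j, j ∉ S → w j ≤ 1 := fun j hj => by
      rw [hw j hj]
      exact (div_le_one hlam).2 (hlam2 j hj)
    have hN : ∀ g ∈ Nbar, ∑ i, ε i * g i ≤ C * √(∑ i, g i ^ 2) := fun g hg =>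
      not_lt.1 fun hlt => hεA ⟨g, hg, hlt⟩
    have hψ : ∀ j, j ∉ S → |∑ i, ε i * ψ j i| / n ≤ lam * w j := fun j hj => by
      have h : |∑ i, ε i * ψ j i| ≤ √L * √(∑ i, ψ j i ^ 2) :=
        not_lt.1 (hεB j (mem_compl.2 hj))
      rw [hw j hj, mul_div_cancel₀ _ hlam.ne', hlam0, Real.sqrt_div' _ hn'.le,
        Real.sqrt_div' _ hn'.le, div_mul_div_comm, Real.mul_self_sqrt hn'.le, mul_comm (√_)]
      gcongr
    have h := adaptive_bound_of_noise_bounds hn D S Nbar ψ hdict hlam w q hw1 hC0 f0 ε f fhat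
      hq1 hq2 hN hψ hmin
    rw [← hΓ, hC, add_div, ← Real.sqrt_div' _ hn'.le, ← Real.sqrt_div' _ hn'.le] at h
    exact h
  have htotal : 1 ≤ P G + (ENNReal.ofReal (Real.exp (-v)) + ENNReal.ofReal (Real.exp (-u))) :=
    calc 1 = P Set.univ := measure_univ.symm
      _ ≤ P G + P (A ∪ ⋃ j ∈ Sᶜ, B j) := (measure_mono hsubset).trans (measure_union_le _ _)
      _ ≤ P G + (ENNReal.ofReal (Real.exp (-v)) + ENNReal.ofReal (Real.exp (-u))) := by
        gcongr
        exact (measure_union_le _ _).trans (add_le_add hA hB)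
  rw [ENNReal.ofReal_sub _ (Real.exp_pos _).le, ENNReal.ofReal_sub _ (Real.exp_pos _).le,
    ENNReal.ofReal_one, tsub_tsub, tsub_le_iff_right, add_comm (ENNReal.ofReal (Real.exp (-u)))]
  exact htotal
end

section
/- Let n ≥ 4, assume Δ(3)·Δ(3)ᵀ is invertible, and let ψ_j^𝒟 denote the j-th column of the Moore–Penrose pseudoinverse Δ(3)⁺ = Δ(3)ᵀ(Δ(3)Δ(3)ᵀ)⁻¹ ∈ ℝ^{n×(n−3)}, for j ∈ {4,…,n}. Then for all j ∈ {4,…,n}, ‖ψ_j^𝒟‖₂² = [(j−3)(j−2)(j−1)(n+3−j)(n+2−j)(n+1−j) / (60(n+2)(n+1)n(n−1)(n−2))] × (10(n+1)(n+2) + 3j(n+4−j)·(j(n+4−j) − 4n − 5)). -/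
open Finset Matrix

/-- The `k`-th order difference operator `Δ(k) ∈ ℝ^{(n-k)×n}`: rows are indexed by
`i ∈ {k+1,…,n}` (here row `r : Fin (n-k)` corresponds to `i = r + k + 1`), columns by
`j ∈ {1,…,n}` (column `c : Fin n` corresponds to `j = c + 1`), and
`Δ(k)_{ij} = (-1)^l * binom(k,l)` if `j = i - l` with `0 ≤ l ≤ k`, else `0`. -/
def Delta (n k : ℕ) : Matrix (Fin (n - k)) (Fin n) ℝ :=
  Matrix.of fun r c =>
    if (r : ℕ) ≤ (c : ℕ) ∧ (c : ℕ) ≤ k + (r : ℕ) then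
      (-1 : ℝ) ^ (k + (r : ℕ) - (c : ℕ)) * (k.choose (k + (r : ℕ) - (c : ℕ)) : ℝ)
    else 0

/-- The Moore–Penrose pseudoinverse `Δ(k)⁺ = Δ(k)ᵀ (Δ(k)Δ(k)ᵀ)⁻¹ ∈ ℝ^{n×(n-k)}`;
its column with index `r : Fin (n-k)` is `ψ_j^𝒟` for `j = r + k + 1 ∈ {k+1,…,n}`. -/
noncomputable def DeltaPinv (n k : ℕ) : Matrix (Fin n) (Fin (n - k)) ℝ :=
  (Delta n k)ᵀ * (Delta n k * (Delta n k)ᵀ)⁻¹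

/-- The entries of `Δ(3)`, diagonal by diagonal. -/
lemma Delta_three_apply (n : ℕ) (r : Fin (n - 3)) (c : Fin n) :
    Delta n 3 r c = (if (c : ℕ) = r + 3 then 1 else 0) - 3 * (if (c : ℕ) = r + 2 then 1 else 0)
      + 3 * (if (c : ℕ) = r + 1 then 1 else 0) - (if (c : ℕ) = r + 0 then 1 else 0) := by
  by_cases h : (r : ℕ) ≤ c ∧ (c : ℕ) ≤ 3 + r
  · obtain ⟨k, hk⟩ := Nat.exists_eq_add_of_le h.1
    have hk3 : k ≤ 3 := by omega
    rw [Delta, Matrix.of_apply, if_pos h, hk, show 3 + (r : ℕ) - (r + k) = 3 - k by omega]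
    interval_cases k <;> norm_num [Nat.choose]
  · have h0 : (c : ℕ) ≠ r + 0 := by omega
    have h1 : (c : ℕ) ≠ r + 1 := by omega
    have h2 : (c : ℕ) ≠ r + 2 := by omega
    have h3 : (c : ℕ) ≠ r + 3 := by omega
    simp only [Delta, Matrix.of_apply, h, h0, h1, h2, h3, if_false]
    norm_num

lemma sum_fin_ite_eq_mul {n : ℕ} (w : ℕ → ℝ) {a : ℕ} (ha : a < n) :
    ∑ c : Fin n, (if (c : ℕ) = a then 1 else 0) * w c = w a := by
  rw [Finset.sum_eq_single (⟨a, ha⟩ : Fin n)]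
  · simp
  · intro b _ hb
    have : (b : ℕ) ≠ a := fun h => hb (Fin.ext h)
    simp [this]
  · simp

/-- `Δ(3)` acts as the third difference. -/
lemma Delta_three_mulVec (n : ℕ) (w : ℕ → ℝ) (r : Fin (n - 3)) :
    (Delta n 3 *ᵥ fun c : Fin n => w c) r = w (r + 3) - 3 * w (r + 2) + 3 * w (r + 1) - w r := by
  have hr := r.isLt
  simp only [Matrix.mulVec, dotProduct, Delta_three_apply, sub_mul, add_mul, mul_assoc,
    Finset.sum_sub_distrib, Finset.sum_add_distrib, ← Finset.mul_sum]
  rw [sum_fin_ite_eq_mul w (by omega), sum_fin_ite_eq_mul w (by omega),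
    sum_fin_ite_eq_mul w (by omega), sum_fin_ite_eq_mul w (by omega), add_zero]

lemma sum_fin_ite_add_mul {n : ℕ} (hn : 3 ≤ n) {g : ℕ → ℝ} (hlow : ∀ t < 3, g t = 0)
    (hhigh : ∀ t, n ≤ t → t < n + 3 → g t = 0) {c k : ℕ} (hc : c < n) (hk : k ≤ 3) :
    ∑ r : Fin (n - 3), (if c = (r : ℕ) + k then 1 else 0) * g (r + 3) = g (c + (3 - k)) := by
  by_cases h : k ≤ c ∧ c - k < n - 3
  · rw [Finset.sum_eq_single (⟨c - k, h.2⟩ : Fin (n - 3))]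
    · rw [if_pos (show c = c - k + k by omega), one_mul]
      congr 1
      dsimp only
      omega
    · intro b _ hb
      have : c ≠ (b : ℕ) + k := fun h' => hb (Fin.ext (by dsimp only; omega))
      simp [this]
    · simp
  · rw [Finset.sum_eq_zero]
    · by_cases hck : k ≤ c
      · exact (hhigh _ (by omega) (by omega)).symm
      · exact (hlow _ (by omega)).symm
    · intro b _
      have hb := b.isLt
      rw [if_neg (by omega), zero_mul]

/-- `Δ(3)ᵀ` acts as the negated third difference on sequences vanishing at three points beyond
each end. -/
lemma Delta_three_transpose_mulVec {n : ℕ} (hn : 3 ≤ n) {g : ℕ → ℝ} (hlow : ∀ t < 3, g t = 0)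
    (hhigh : ∀ t, n ≤ t → t < n + 3 → g t = 0) :
    ((Delta n 3)ᵀ *ᵥ fun r : Fin (n - 3) => g (r + 3)) =
      fun c : Fin n => g c - 3 * g (c + 1) + 3 * g (c + 2) - g (c + 3) := by
  funext c
  simp only [Matrix.mulVec, dotProduct, Matrix.transpose_apply, Delta_three_apply, sub_mul,
    add_mul, mul_assoc, Finset.sum_sub_distrib, Finset.sum_add_distrib, ← Finset.mul_sum]
  rw [sum_fin_ite_add_mul hn hlow hhigh c.isLt (by norm_num),
    sum_fin_ite_add_mul hn hlow hhigh c.isLt (by norm_num),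
    sum_fin_ite_add_mul hn hlow hhigh c.isLt (by norm_num),
    sum_fin_ite_add_mul hn hlow hhigh c.isLt (by norm_num)]
  rfl

/-- The squared norm of a column of the pseudoinverse is a diagonal entry of `(Δ(k)Δ(k)ᵀ)⁻¹`,
hence is determined by the solution of `Δ(k)Δ(k)ᵀ v = e_s`. -/
lemma sum_DeltaPinv_sq {n k : ℕ} (hinv : IsUnit (Delta n k * (Delta n k)ᵀ).det)
    (s : Fin (n - k)) {v : Fin (n - k) → ℝ}
    (hv : Delta n k *ᵥ ((Delta n k)ᵀ *ᵥ v) = Pi.single s 1) :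
    ∑ i, DeltaPinv n k i s ^ 2 = v s := by
  have hcol : (fun i => DeltaPinv n k i s) = (Delta n k)ᵀ *ᵥ v := by
    calc (fun i => DeltaPinv n k i s) = DeltaPinv n k *ᵥ Pi.single s 1 := by
          rw [Matrix.mulVec_single_one]; rfl
      _ = (Delta n k)ᵀ *ᵥ v := by
          rw [← hv, DeltaPinv, Matrix.mulVec_mulVec, Matrix.mulVec_mulVec, Matrix.mul_assoc,
            Matrix.mul_assoc, Matrix.nonsing_inv_mul _ hinv, Matrix.mul_one]
  calc ∑ i, DeltaPinv n k i s ^ 2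
      = (fun i => DeltaPinv n k i s) ⬝ᵥ (fun i => DeltaPinv n k i s) := by
        simp only [dotProduct, sq]
    _ = v ⬝ᵥ (Delta n k *ᵥ ((Delta n k)ᵀ *ᵥ v)) := by
        rw [hcol, Matrix.dotProduct_mulVec v, Matrix.mulVec_transpose]
    _ = v s := by rw [hv, dotProduct_single, mul_one]

/-- The polynomial `binom(t - s - 1, 5)`, truncated to `0` for `t ≤ s + 5`. -/
noncomputable def truncQuintic (s t : ℕ) : ℝ :=
  if t ≤ s + 5 then 0 else
    ((t : ℝ) - s - 1) * ((t : ℝ) - s - 2) * ((t : ℝ) - s - 3) * ((t : ℝ) - s - 4) *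
      ((t : ℝ) - s - 5) / 120

lemma truncQuintic_of_le {s t : ℕ} (h : t ≤ s + 5) : truncQuintic s t = 0 := if_pos h

lemma truncQuintic_of_lt {s t : ℕ} (h : s < t) : truncQuintic s t =
    ((t : ℝ) - s - 1) * ((t : ℝ) - s - 2) * ((t : ℝ) - s - 3) * ((t : ℝ) - s - 4) *
      ((t : ℝ) - s - 5) / 120 := by
  by_cases h5 : t ≤ s + 5
  · rw [truncQuintic_of_le h5]
    obtain ⟨x, rfl⟩ := Nat.exists_eq_add_of_lt h
    have : x < 5 := by omega
    interval_cases x <;> push_cast <;> ring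
  · rw [truncQuintic, if_neg h5]

/-- The sixth difference of the truncated quintic is a unit impulse. -/
lemma truncQuintic_sixth_difference (s r : ℕ) :
    truncQuintic s (r + 6) - 6 * truncQuintic s (r + 5) + 15 * truncQuintic s (r + 4)
      - 20 * truncQuintic s (r + 3) + 15 * truncQuintic s (r + 2) - 6 * truncQuintic s (r + 1)
      + truncQuintic s r = if r = s then 1 else 0 := by
  rcases lt_trichotomy r s with h | rfl | h
  · rw [if_neg h.ne]
    repeat rw [truncQuintic_of_le (by omega)]
    norm_num
  · rw [if_pos rfl, truncQuintic_of_lt (t := r + 6) (by omega)]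
    repeat rw [truncQuintic_of_le (by omega)]
    push_cast
    ring
  · rw [if_neg h.ne']
    repeat rw [truncQuintic_of_lt (by omega)]
    push_cast
    ring

/-- The quadratic interpolating `truncQuintic s t / (t (t - 1) (t - 2))` at `n`, `n + 1`,
`n + 2`. -/
noncomputable def greenQuadratic (n s : ℕ) (x : ℝ) : ℝ :=
  truncQuintic s n / ((n : ℝ) * (n - 1) * (n - 2)) * ((x - n - 1) * (x - n - 2) / 2)
    - truncQuintic s (n + 1) / (((n : ℝ) + 1) * n * (n - 1)) * ((x - n) * (x - n - 2))
    + truncQuintic s (n + 2) / (((n : ℝ) + 2) * (n + 1) * n) * ((x - n) * (x - n - 1) / 2)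

/-- The Green's function of `Δ(3)Δ(3)ᵀ` with pole `s`, with argument shifted by `3`. -/
noncomputable def greenFun (n s t : ℕ) : ℝ :=
  (t : ℝ) * (t - 1) * (t - 2) * greenQuadratic n s t - truncQuintic s t

lemma greenFun_low (n s : ℕ) : ∀ t < 3, greenFun n s t = 0 := by
  intro t ht
  rw [greenFun, truncQuintic_of_le (by omega)]
  interval_cases t <;> norm_num

lemma greenFun_high {n : ℕ} (hn : 3 ≤ n) (s : ℕ) :
    ∀ t, n ≤ t → t < n + 3 → greenFun n s t = 0 := by
  intro t ht ht'
  have hn' : (3 : ℝ) ≤ n := by exact_mod_cast hn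
  have h0 : (n : ℝ) ≠ 0 := by linarith
  have h1 : (n : ℝ) - 1 ≠ 0 := by linarith
  have h2 : (n : ℝ) - 2 ≠ 0 := by linarith
  have h3 : (n : ℝ) + 1 ≠ 0 := by linarith
  have h4 : (n : ℝ) + 2 ≠ 0 := by linarith
  obtain ⟨k, rfl⟩ := Nat.exists_eq_add_of_le ht
  have hk : k < 3 := by omega
  interval_cases k <;> simp only [greenFun, greenQuadratic, add_zero] <;> push_cast <;>
    field_simp <;> ring

lemma greenFun_sixth_difference (n s r : ℕ) :
    greenFun n s (r + 6) - 6 * greenFun n s (r + 5) + 15 * greenFun n s (r + 4)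
      - 20 * greenFun n s (r + 3) + 15 * greenFun n s (r + 2) - 6 * greenFun n s (r + 1)
      + greenFun n s r = - if r = s then 1 else 0 := by
  rw [← truncQuintic_sixth_difference]
  simp only [greenFun, greenQuadratic]
  generalize truncQuintic s n / ((n : ℝ) * (n - 1) * (n - 2)) = a
  generalize truncQuintic s (n + 1) / (((n : ℝ) + 1) * n * (n - 1)) = b
  generalize truncQuintic s (n + 2) / (((n : ℝ) + 2) * (n + 1) * n) = c
  push_cast
  ring

lemma Delta_three_mulVec_greenFun {n : ℕ} (hn : 3 ≤ n) (s : Fin (n - 3)) :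
    Delta n 3 *ᵥ ((Delta n 3)ᵀ *ᵥ fun r : Fin (n - 3) => greenFun n s (r + 3)) =
      Pi.single s 1 := by
  rw [Delta_three_transpose_mulVec hn (greenFun_low n s) (greenFun_high hn s)]
  funext r
  rw [Delta_three_mulVec n (fun c => greenFun n s c - 3 * greenFun n s (c + 1)
    + 3 * greenFun n s (c + 2) - greenFun n s (c + 3)) r]
  have h := greenFun_sixth_difference n s r
  simp only [Pi.single_apply, Fin.ext_iff]
  simp only [add_assoc, Nat.reduceAdd] at h ⊢
  linarith

/-- Lemma 3.3: for `k = 3` and `j ∈ {4,…,n}`,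
`‖ψ_j^𝒟‖₂² = [(j-3)(j-2)(j-1)(n+3-j)(n+2-j)(n+1-j) / (60(n+2)(n+1)n(n-1)(n-2))]
  × (10(n+1)(n+2) + 3j(n+4-j)(j(n+4-j) - 4n - 5))`. -/
theorem stmt_6
    (n : ℕ) (hn : 4 ≤ n)
    (hinv : IsUnit (Delta n 3 * (Delta n 3)ᵀ).det) :
    ∀ (j : ℕ) (hj1 : 4 ≤ j) (hj2 : j ≤ n),
      (∑ i, (DeltaPinv n 3 i ⟨j - 4, by omega⟩) ^ 2) =
        ((j : ℝ) - 3) * ((j : ℝ) - 2) * ((j : ℝ) - 1) *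
            ((n : ℝ) + 3 - j) * ((n : ℝ) + 2 - j) * ((n : ℝ) + 1 - j) /
            (60 * ((n : ℝ) + 2) * ((n : ℝ) + 1) * (n : ℝ) * ((n : ℝ) - 1) * ((n : ℝ) - 2)) *
          (10 * ((n : ℝ) + 1) * ((n : ℝ) + 2) +
            3 * (j : ℝ) * ((n : ℝ) + 4 - j) * ((j : ℝ) * ((n : ℝ) + 4 - j) - 4 * (n : ℝ) - 5)) := by
  intro j hj1 hj2
  rw [sum_DeltaPinv_sq hinv ⟨j - 4, by omega⟩ (Delta_three_mulVec_greenFun (by omega) _)]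
  obtain ⟨s, rfl⟩ := Nat.exists_eq_add_of_le' hj1
  have hn' : (4 : ℝ) ≤ n := by exact_mod_cast hn
  have h0 : (n : ℝ) ≠ 0 := by linarith
  have h1 : (n : ℝ) - 1 ≠ 0 := by linarith
  have h2 : (n : ℝ) - 2 ≠ 0 := by linarith
  have h3 : (n : ℝ) + 1 ≠ 0 := by linarith
  have h4 : (n : ℝ) + 2 ≠ 0 := by linarith
  simp only [Nat.add_sub_cancel, greenFun, greenQuadratic]
  rw [truncQuintic_of_le (t := s + 3) (by omega), truncQuintic_of_lt (t := n) (by omega),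
    truncQuintic_of_lt (t := n + 1) (by omega), truncQuintic_of_lt (t := n + 2) (by omega)]
  push_cast
  field_simp
  ring
end

section
/- Let n, m be positive integers, D ∈ ℝ^{m×n} with rows indexed by a set 𝒟 of size m, S ⊆ 𝒟 with |S| = s < m, N̄_{-S} ⊇ N_{-S} a linear subspace with r̄_S := dim(N̄_{-S}), and Ψ^{-S} = {ψ_j^{-S}}_{j∈𝒟∖S} a dictionary for N̄_{-S}. Let ε ∈ ℝ^n have n i.i.d. standard Gaussian N(0,1) coordinates. Let u > 0, v > 0, let λ > 0 satisfy λ ≥ max_{j∈𝒟∖S} ‖ψ_j^{-S}‖_n · λ₀(u), and set w_j := ‖ψ_j^{-S}‖_n·λ₀(u)/λ for j ∈ 𝒟∖S. Then with probability at least 1 − e^{−u} − e^{−v} (with respect to the law of ε): for all f ∈ ℝ^n, εᵀf/n ≤ (√(r̄_S/n) + √(2v/n))·‖f‖_n + λ·Σ_{j∈𝒟∖S} w_j·|(Df)_j|. -/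
open MeasureTheory ProbabilityTheory Finset

theorem integral_exp_mul_sq_gaussianReal {t : ℝ} (ht : t < 1 / 2) :
    ∫ x, Real.exp (t * x ^ 2) ∂(gaussianReal 0 1) = (√(1 - 2 * t))⁻¹ := by
  rw [integral_gaussianReal_eq_integral_smul one_ne_zero]
  have h : ∀ x : ℝ, gaussianPDFReal 0 1 x • Real.exp (t * x ^ 2) =
      (√(2 * Real.pi))⁻¹ * Real.exp (-(1 / 2 - t) * x ^ 2) := by
    intro x
    rw [gaussianPDFReal, smul_eq_mul, mul_assoc, ← Real.exp_add]
    simp only [NNReal.coe_one, mul_one, sub_zero]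
    ring_nf
  have hpi := Real.pi_pos
  simp_rw [h]
  rw [integral_const_mul, integral_gaussian, ← Real.sqrt_inv, ← Real.sqrt_inv,
    ← Real.sqrt_mul (by positivity)]
  congr 1
  have : 1 - 2 * t ≠ 0 := by linarith
  have : 1 / 2 - t ≠ 0 := by linarith
  field_simp

section InnerProductSpace

variable {E : Type*} [NormedAddCommGroup E] [InnerProductSpace ℝ E]

theorem norm_le_of_sub_mem_of_inner_eq_zero {W : Submodule ℝ E} {f h : E} (hf : f - h ∈ W)
    (hh : ∀ g ∈ W, inner ℝ h g = 0) : ‖f - h‖ ≤ ‖f‖ := by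
  have h1 : ‖f‖ ^ 2 = ‖f - h‖ ^ 2 + ‖h‖ ^ 2 := by
    conv_lhs => rw [← sub_add_cancel f h]
    rw [norm_add_sq_real, real_inner_comm, hh _ hf]
    ring
  exact le_of_sq_le_sq (by nlinarith [sq_nonneg ‖h‖]) (norm_nonneg f)

variable [FiniteDimensional ℝ E]

theorem inner_le_norm_orthogonalProjectionOnto_mul {W : Submodule ℝ E} {x g : E} (hg : g ∈ W) :
    inner ℝ x g ≤ ‖W.orthogonalProjectionOnto x‖ * ‖g‖ := by
  have := real_inner_le_norm (W.orthogonalProjectionOnto x) ⟨g, hg⟩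
  rwa [Submodule.inner_orthogonalProjectionOnto_eq_of_mem_right] at this

variable [MeasurableSpace E] [BorelSpace E]

theorem integral_exp_mul_norm_sq_stdGaussian {t : ℝ} (ht : t < 1 / 2) :
    ∫ x, Real.exp (t * ‖x‖ ^ 2) ∂(stdGaussian E) =
      (√(1 - 2 * t))⁻¹ ^ Module.finrank ℝ E := by
  rw [stdGaussian, integral_map (Measurable.aemeasurable (by fun_prop))
    (Measurable.aestronglyMeasurable (by fun_prop))]
  have h (x : Fin (Module.finrank ℝ E) → ℝ) :
      Real.exp (t * ‖∑ i, x i • stdOrthonormalBasis ℝ E i‖ ^ 2) =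
        ∏ i, Real.exp (t * x i ^ 2) := by
    rw [← Real.exp_sum, ← Finset.mul_sum, ← (stdOrthonormalBasis ℝ E).sum_sq_inner_right]
    simp [inner_sum, inner_smul_right, orthonormal_iff_ite.mp (stdOrthonormalBasis ℝ E).orthonormal]
  simp_rw [h]
  rw [integral_fintype_prod_eq_prod (f := fun _ x ↦ Real.exp (t * x ^ 2))]
  simp [integral_exp_mul_sq_gaussianReal ht]

theorem stdGaussian_norm_gt_le {v : ℝ} (hv : 0 < v) :
    stdGaussian E {x | √(Module.finrank ℝ E : ℝ) + √(2 * v) < ‖x‖} ≤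
      ENNReal.ofReal (Real.exp (-v)) := by
  rcases Nat.eq_zero_or_pos (Module.finrank ℝ E) with h0 | hr
  · have : Subsingleton E := Module.finrank_zero_iff.mp h0
    have hempty : {x : E | √(Module.finrank ℝ E : ℝ) + √(2 * v) < ‖x‖} = ∅ := by
      ext x
      simp only [Set.mem_ofPred_eq, Set.mem_empty_iff_false, iff_false, not_lt]
      rw [Subsingleton.elim x 0, norm_zero]
      positivity
    rw [hempty, measure_empty]
    exact zero_le
  set p := √(Module.finrank ℝ E : ℝ) with hp
  set q := √(2 * v) with hq
  have hp0 : 0 < p := Real.sqrt_pos.mpr (by exact_mod_cast hr)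
  have hq0 : 0 < q := Real.sqrt_pos.mpr (by linarith)
  have hpsq : p ^ 2 = Module.finrank ℝ E := Real.sq_sqrt (by positivity)
  have hqsq : q ^ 2 = 2 * v := Real.sq_sqrt (by linarith)
  -- the optimal Chernoff parameter
  set t := (1 - (p / (p + q)) ^ 2) / 2 with ht
  have hx1 : p / (p + q) < 1 := (div_lt_one (by positivity)).mpr (by linarith)
  have hx0 : 0 < p / (p + q) := by positivity
  have ht0 : 0 ≤ t := by nlinarith
  have ht1 : t < 1 / 2 := by nlinarith [sq_pos_of_pos hx0]
  have hsqrt : (√(1 - 2 * t))⁻¹ = 1 + q / p := by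
    have : 1 - 2 * t = (p / (p + q)) ^ 2 := by rw [ht]; ring
    rw [this, Real.sqrt_sq hx0.le]
    field_simp
  have hmgf : mgf (fun x : E ↦ ‖x‖ ^ 2) (stdGaussian E) t =
      (1 + q / p) ^ Module.finrank ℝ E := by
    rw [mgf, integral_exp_mul_norm_sq_stdGaussian ht1, hsqrt]
  have hint : Integrable (fun x : E ↦ Real.exp (t * ‖x‖ ^ 2)) (stdGaussian E) := by
    refine not_imp_comm.mp integral_undef ?_
    rw [integral_exp_mul_norm_sq_stdGaussian ht1, hsqrt]
    positivity
  have hch := measure_ge_le_exp_mul_mgf ((p + q) ^ 2) ht0 hint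
  have hpow : (1 + q / p) ^ Module.finrank ℝ E ≤ Real.exp (p * q) := by
    calc (1 + q / p) ^ Module.finrank ℝ E ≤ (Real.exp (q / p)) ^ Module.finrank ℝ E := by
          gcongr
          linarith [Real.add_one_le_exp (q / p)]
      _ = Real.exp (p * q) := by
          rw [← Real.exp_nat_mul, ← hpsq]
          congr 1
          field_simp
  have hexp : -t * (p + q) ^ 2 + p * q = -v := by
    have : t * (p + q) ^ 2 = ((p + q) ^ 2 - p ^ 2) / 2 := by
      rw [ht]; field_simp
    linarith
  calc stdGaussian E {x | p + q < ‖x‖}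
      ≤ stdGaussian E {x | (p + q) ^ 2 ≤ ‖x‖ ^ 2} := by
        refine measure_mono fun x (hx : p + q < ‖x‖) ↦ ?_
        exact pow_le_pow_left₀ (by positivity) hx.le 2
    _ = ENNReal.ofReal ((stdGaussian E).real {x | (p + q) ^ 2 ≤ ‖x‖ ^ 2}) := by simp
    _ ≤ ENNReal.ofReal (Real.exp (-v)) := by
        refine ENNReal.ofReal_le_ofReal (hch.trans ?_)
        rw [hmgf, ← hexp, Real.exp_add]
        gcongr

theorem map_orthogonalProjectionOnto_stdGaussian (W : Submodule ℝ E) :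
    (stdGaussian E).map W.orthogonalProjectionOnto = stdGaussian W := by
  apply Measure.ext_of_charFun
  ext t
  rw [charFun_stdGaussian, charFun_apply, integral_map (by fun_prop) (by fun_prop)]
  simp_rw [Submodule.inner_orthogonalProjectionOnto_eq_of_mem_right]
  rw [← charFun_apply, charFun_stdGaussian]
  simp

theorem stdGaussian_abs_inner_gt_le (a : E) {τ : ℝ} (hτ : 0 ≤ τ) :
    stdGaussian E {x | ‖a‖ * τ < |inner ℝ a x|} ≤
      ENNReal.ofReal (2 * Real.exp (-τ ^ 2 / 2)) := by
  rcases eq_or_ne a 0 with rfl | ha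
  · simp
  have ha0 : 0 < ‖a‖ := norm_pos_iff.mpr ha
  have hmap : (stdGaussian E).map (innerSL ℝ a) = gaussianReal 0 (‖a‖₊ ^ 2) := by
    rw [IsGaussian.map_eq_gaussianReal, integral_strongDual_stdGaussian,
      variance_dual_stdGaussian, innerSL_apply_norm]
    congr 1
    ext
    simp
  have hsub : HasSubgaussianMGF (fun x ↦ inner ℝ a x) (‖a‖₊ ^ 2) (stdGaussian E) := by
    refine (HasSubgaussianMGF.id_map_iff (by fun_prop)).mp ?_
    change HasSubgaussianMGF id _ ((stdGaussian E).map (innerSL ℝ a))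
    rw [hmap]
    refine ⟨fun t ↦ not_imp_comm.mp integral_undef ?_, fun t ↦ ?_⟩
    · change mgf id (gaussianReal 0 (‖a‖₊ ^ 2)) t ≠ 0
      rw [mgf_id_gaussianReal]
      positivity
    · simp [mgf_id_gaussianReal]
  have htail {X : E → ℝ} (hX : HasSubgaussianMGF X (‖a‖₊ ^ 2) (stdGaussian E)) :
      stdGaussian E {x | ‖a‖ * τ ≤ X x} ≤ ENNReal.ofReal (Real.exp (-τ ^ 2 / 2)) := by
    rw [← ofReal_measureReal]
    refine ENNReal.ofReal_le_ofReal ((hX.measure_ge_le (by positivity)).trans_eq ?_)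
    congr 1
    simp only [NNReal.coe_pow, coe_nnnorm]
    field_simp
  calc stdGaussian E {x | ‖a‖ * τ < |inner ℝ a x|}
      ≤ stdGaussian E ({x | ‖a‖ * τ ≤ inner ℝ a x} ∪ {x | ‖a‖ * τ ≤ (-fun x ↦ inner ℝ a x) x}) := by
        refine measure_mono fun x (hx : ‖a‖ * τ < |inner ℝ a x|) ↦ ?_
        exact (lt_abs.mp hx).imp le_of_lt le_of_lt
    _ ≤ _ := measure_union_le _ _
    _ ≤ _ := add_le_add (htail hsub) (htail hsub.neg)
    _ = _ := by rw [← ENNReal.ofReal_add (by positivity) (by positivity), two_mul]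

/-- With probability at least `1 - e^{-u} - e^{-v}`, a standard Gaussian vector `x` satisfies both
the chi-type bound on its projection onto `W` and the maximal inequality over the `a j`. -/
theorem stdGaussian_projection_and_max_ge {ι : Type*} (W : Submodule ℝ E) (T : Finset ι)
    (hT : T.Nonempty) (a : ι → E) {u v : ℝ} (hu : 0 < u) (hv : 0 < v) :
    ENNReal.ofReal (1 - Real.exp (-u) - Real.exp (-v)) ≤
      stdGaussian E {x | ‖W.orthogonalProjectionOnto x‖ ≤
          √(Module.finrank ℝ W : ℝ) + √(2 * v) ∧
        ∀ j ∈ T, |inner ℝ (a j) x| ≤ ‖a j‖ * √(2 * Real.log (2 * (#T : ℝ)) + 2 * u)} := by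
  set τ := √(2 * Real.log (2 * (#T : ℝ)) + 2 * u) with hτ
  have hcard : (1 : ℝ) ≤ #T := by exact_mod_cast hT.card_pos
  have hlog : 0 ≤ Real.log (2 * (#T : ℝ)) := Real.log_nonneg (by linarith)
  have hτsq : τ ^ 2 = 2 * Real.log (2 * (#T : ℝ)) + 2 * u := Real.sq_sqrt (by positivity)
  set B : Set E := {x | √(Module.finrank ℝ W : ℝ) + √(2 * v) < ‖W.orthogonalProjectionOnto x‖}
  set C : Set E := ⋃ j ∈ T, {x | ‖a j‖ * τ < |inner ℝ (a j) x|}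
  have hB : stdGaussian E B ≤ ENNReal.ofReal (Real.exp (-v)) := by
    have h := stdGaussian_norm_gt_le (E := W) hv
    rw [← map_orthogonalProjectionOnto_stdGaussian] at h
    exact (Measure.le_map_apply (f := W.orthogonalProjectionOnto) (by fun_prop)
      {x : W | √(Module.finrank ℝ W : ℝ) + √(2 * v) < ‖x‖}).trans h
  have hC : stdGaussian E C ≤ ENNReal.ofReal (Real.exp (-u)) := by
    calc stdGaussian E C ≤ ∑ j ∈ T, stdGaussian E {x | ‖a j‖ * τ < |inner ℝ (a j) x|} :=
          measure_biUnion_finset_le _ _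
      _ ≤ ∑ j ∈ T, ENNReal.ofReal (2 * Real.exp (-τ ^ 2 / 2)) :=
          Finset.sum_le_sum fun j _ ↦ stdGaussian_abs_inner_gt_le (a j) (Real.sqrt_nonneg _)
      _ = ENNReal.ofReal (Real.exp (-u)) := by
          rw [Finset.sum_const, nsmul_eq_mul, ← ENNReal.ofReal_natCast,
            ← ENNReal.ofReal_mul (by positivity), hτsq]
          congr 1
          have : -(2 * Real.log (2 * (#T : ℝ)) + 2 * u) / 2 =
              -Real.log (2 * (#T : ℝ)) + -u := by ring
          rw [this, Real.exp_add, Real.exp_neg (Real.log _), Real.exp_log (by positivity)]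
          field_simp
  rw [ENNReal.ofReal_sub _ (Real.exp_nonneg _), ENNReal.ofReal_sub _ (Real.exp_nonneg _),
    ENNReal.ofReal_one, tsub_le_iff_right, tsub_le_iff_right]
  refine le_trans ?_ (add_le_add (add_le_add le_rfl hB) hC)
  rw [← measure_univ (μ := stdGaussian E)]
  refine le_trans (measure_mono fun x _ ↦ ?_) ((measure_union_le _ C).trans
    (add_le_add (measure_union_le _ B) le_rfl))
  by_cases hxB : x ∈ B
  · exact Or.inl (Or.inr hxB)
  by_cases hxC : x ∈ C
  · exact Or.inr hxC
  · simp only [C, Set.mem_iUnion, Set.mem_ofPred_eq, not_exists, not_lt] at hxC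
    exact Or.inl (Or.inl ⟨not_lt.mp hxB, hxC⟩)
end InnerProductSpace

theorem sqrt_sum_sq_div {n : ℕ} (f : Fin n → ℝ) :
    √((∑ i, f i ^ 2) / n) = ‖WithLp.toLp 2 f‖ / √n := by
  rw [EuclideanSpace.norm_eq, Real.sqrt_div' _ (Nat.cast_nonneg n)]
  simp

/-- Lemma A.2, bound on the empirical process with mock variables:
with probability at least `1 - e^{-u} - e^{-v}`, for all `f ∈ ℝⁿ`,
`εᵀf/n ≤ (√(r̄_S/n) + √(2v/n))‖f‖ₙ + λ ∑_{j ∉ S} w_j |(Df)_j|`. -/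
theorem stmt_13
    (n m : ℕ) (hn : 0 < n) (hm : 0 < m)
    (D : Matrix (Fin m) (Fin n) ℝ)
    (S : Finset (Fin m)) (hs : S.card < m)
    -- `Nbar` is a linear subspace containing `N_{-S} = {f : (Df)_j = 0 ∀ j ∉ S}`
    (Nbar : Submodule ℝ (Fin n → ℝ))
    (hsub : ∀ f : Fin n → ℝ, (∀ j, j ∉ S → D.mulVec f j = 0) → f ∈ Nbar)
    -- `ψ` is a dictionary for `Nbar`: for every `f`, the orthogonal projection of `f`
    -- onto the orthogonal complement of `Nbar` is `∑_{j ∉ S} (Df)_j • ψ_j`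
    (ψ : Fin m → (Fin n → ℝ))
    (hdict : ∀ f : Fin n → ℝ,
      f - (∑ j ∈ Sᶜ, D.mulVec f j • ψ j) ∈ Nbar ∧
      ∀ g ∈ Nbar, (∑ i, (∑ j ∈ Sᶜ, D.mulVec f j • ψ j) i * g i) = 0)
    (u v lam : ℝ) (hu : 0 < u) (hv : 0 < v) (hlam : 0 < lam)
    -- `λ₀(u) = √((2 log(2(m-s)) + 2u)/n)`
    (lam0 : ℝ)
    (hlam0 : lam0 = Real.sqrt ((2 * Real.log (2 * ((m : ℝ) - S.card)) + 2 * u) / n))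
    -- `λ ≥ max_{j ∉ S} ‖ψⱼ‖ₙ λ₀(u)`
    (hlam2 : ∀ j, j ∉ S → Real.sqrt ((∑ i, ψ j i ^ 2) / n) * lam0 ≤ lam)
    -- the weights `w_j = ‖ψⱼ‖ₙ λ₀(u)/λ` for `j ∉ S`
    (w : Fin m → ℝ)
    (hw : ∀ j, j ∉ S → w j = Real.sqrt ((∑ i, ψ j i ^ 2) / n) * lam0 / lam) :
    ENNReal.ofReal (1 - Real.exp (-u) - Real.exp (-v)) ≤
      (Measure.pi fun _ : Fin n => gaussianReal 0 1)
        {ε : Fin n → ℝ |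
          ∀ f : Fin n → ℝ,
            (∑ i, ε i * f i) / n ≤
              (Real.sqrt ((Module.finrank ℝ Nbar : ℝ) / n) + Real.sqrt (2 * v / n)) *
                  Real.sqrt ((∑ i, f i ^ 2) / n)
                + lam * ∑ j ∈ Sᶜ, w j * |D.mulVec f j|} := by
  set W : Submodule ℝ (EuclideanSpace ℝ (Fin n)) :=
    Nbar.map (WithLp.linearEquiv 2 ℝ (Fin n → ℝ)).symm.toLinearMap with hW
  have hrank : Module.finrank ℝ W = Module.finrank ℝ Nbar := LinearEquiv.finrank_map_eq _ _
  have hcard : (#Sᶜ : ℝ) = m - #S := by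
    rw [Finset.card_compl, Fintype.card_fin, Nat.cast_sub hs.le]
  have hne : Sᶜ.Nonempty := by
    rw [← Finset.card_pos, Finset.card_compl, Fintype.card_fin]
    omega
  have key := stdGaussian_projection_and_max_ge W Sᶜ hne (fun j ↦ WithLp.toLp 2 (ψ j)) hu hv
  rw [hrank, hcard, ← map_pi_eq_stdGaussian, Measure.map_apply (by fun_prop)] at key
  swap
  · measurability
  refine key.trans (measure_mono fun ε hε f ↦ ?_)
  obtain ⟨hε1, hε2⟩ := hε
  set τ := √(2 * Real.log (2 * ((m : ℝ) - #S)) + 2 * u)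
  have hn' : (0 : ℝ) < n := by exact_mod_cast hn
  have hlam0' : lam0 = τ / √n := by rw [hlam0, Real.sqrt_div' _ hn'.le]
  have hmem (g : Fin n → ℝ) (hg : g ∈ Nbar) : WithLp.toLp 2 g ∈ W := ⟨g, hg, rfl⟩
  set h : Fin n → ℝ := ∑ j ∈ Sᶜ, D.mulVec f j • ψ j with hh
  obtain ⟨hf1, hf2⟩ := hdict f
  have hinner (x y : Fin n → ℝ) :
      inner ℝ (WithLp.toLp 2 x) (WithLp.toLp 2 y) = ∑ i, x i * y i := by
    simp [PiLp.inner_apply, mul_comm]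
  have hproj : ∑ i, ε i * (f - h) i ≤
      (√(Module.finrank ℝ Nbar : ℝ) + √(2 * v)) * ‖WithLp.toLp 2 f‖ := by
    have h1 : ‖WithLp.toLp 2 f - WithLp.toLp 2 h‖ ≤ ‖WithLp.toLp 2 f‖ := by
      refine norm_le_of_sub_mem_of_inner_eq_zero (W := W) (hmem _ hf1) ?_
      rintro _ ⟨g, hg, rfl⟩
      exact (hinner h g).trans (hf2 g hg)
    rw [← hinner]
    exact (inner_le_norm_orthogonalProjectionOnto_mul (hmem _ hf1)).trans
      (mul_le_mul hε1 h1 (norm_nonneg _) (by positivity))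
  have hdic : ∑ i, ε i * h i ≤ ∑ j ∈ Sᶜ, ‖WithLp.toLp 2 (ψ j)‖ * τ * |D.mulVec f j| := by
    have : ∑ i, ε i * h i =
        ∑ j ∈ Sᶜ, inner ℝ (WithLp.toLp 2 (ψ j)) (WithLp.toLp 2 ε) * D.mulVec f j := by
      simp_rw [hinner, hh, Finset.sum_apply, Pi.smul_apply, smul_eq_mul, Finset.mul_sum,
        Finset.sum_mul]
      rw [Finset.sum_comm]
      exact Finset.sum_congr rfl fun j _ ↦ Finset.sum_congr rfl fun i _ ↦ by ring
    rw [this]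
    refine Finset.sum_le_sum fun j hj ↦ (le_abs_self _).trans ?_
    rw [abs_mul]
    exact mul_le_mul_of_nonneg_right (hε2 j hj) (abs_nonneg _)
  have hweights : lam * ∑ j ∈ Sᶜ, w j * |D.mulVec f j| =
      (∑ j ∈ Sᶜ, ‖WithLp.toLp 2 (ψ j)‖ * τ * |D.mulVec f j|) / n := by
    rw [Finset.mul_sum, Finset.sum_div]
    refine Finset.sum_congr rfl fun j hj ↦ ?_
    rw [hw j (Finset.mem_compl.mp hj), sqrt_sum_sq_div, hlam0']
    nth_rw 3 [← Real.mul_self_sqrt hn'.le]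
    field_simp
  have hmain : (√((Module.finrank ℝ Nbar : ℝ) / n) + √(2 * v / n)) * √((∑ i, f i ^ 2) / n) =
      (√(Module.finrank ℝ Nbar : ℝ) + √(2 * v)) * ‖WithLp.toLp 2 f‖ / n := by
    rw [sqrt_sum_sq_div, Real.sqrt_div' _ hn'.le, Real.sqrt_div' _ hn'.le, ← add_div,
      div_mul_div_comm, Real.mul_self_sqrt hn'.le]
  have hsplit : ∑ i, ε i * f i = ∑ i, ε i * (f - h) i + ∑ i, ε i * h i := by
    rw [← Finset.sum_add_distrib]
    exact Finset.sum_congr rfl fun i _ ↦ by rw [Pi.sub_apply]; ring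
  rw [hweights, hmain, ← add_div, hsplit]
  gcongr
end
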